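/- The function V is strictly increasing on the interval (0, d]: for all 0 < σ₁ < σ₂ ≤ d, V(σ₁) < V(σ₂). -/

import Mathlib

open Real MeasureTheory

/-- Gaussian density with mean 0 and standard deviation `σ`. -/
noncomputable def gauss (σ x : ℝ) : ℝ :=
  (1 / (σ * Real.sqrt (2 * Real.pi))) * Real.exp (-x ^ 2 / (2 * σ ^ 2))

/-- The value function determined by the Q-function `Q`. -/
noncomputable def V (Q : ℝ → ℝ) (σ : ℝ) : ℝ := ∫ x, gauss σ x * Q x

theorem continuous_gauss (σ : ℝ) : Continuous (gauss σ) := by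
  unfold gauss
  fun_prop

theorem gauss_nonneg {σ : ℝ} (hσ : 0 < σ) (x : ℝ) : 0 ≤ gauss σ x := by
  unfold gauss
  positivity

theorem integrable_gauss {σ : ℝ} (hσ : 0 < σ) : Integrable (gauss σ) := by
  have hb : 0 < 1 / (2 * σ ^ 2) := by positivity
  refine ((integrable_exp_neg_mul_sq hb).const_mul (1 / (σ * √(2 * π)))).congr
    (.of_forall fun x => ?_)
  simp only [gauss]
  congr 2
  ring

theorem integrable_gauss_mul {σ C : ℝ} (hσ : 0 < σ) {Q : ℝ → ℝ} (hQmeas : Measurable Q)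
    (hQbdd : ∀ x, Q x ≤ C) (hQnonneg : ∀ x, 0 ≤ Q x) :
    Integrable fun x => gauss σ x * Q x := by
  refine ((integrable_gauss hσ).mul_const C).mono'
    ((continuous_gauss σ).measurable.mul hQmeas).aestronglyMeasurable (.of_forall fun x => ?_)
  rw [Real.norm_of_nonneg (mul_nonneg (gauss_nonneg hσ x) (hQnonneg x))]
  exact mul_le_mul_of_nonneg_left (hQbdd x) (gauss_nonneg hσ x)

/-- At a fixed point `x > 0`, the Gaussian density increases with `σ` on `(0, x]`. -/
theorem gauss_lt_gauss {σ₁ σ₂ x : ℝ} (h₁ : 0 < σ₁) (h₁₂ : σ₁ < σ₂) (hx : σ₂ ≤ x) :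
    gauss σ₁ x < gauss σ₂ x := by
  have h₂ : 0 < σ₂ := h₁.trans h₁₂
  set u := x ^ 2 / (2 * σ₁ ^ 2) - x ^ 2 / (2 * σ₂ ^ 2) with hu
  have hratio : σ₂ / σ₁ < 1 + u := by
    have hfactor : u = x ^ 2 / σ₂ ^ 2 * (((σ₂ / σ₁) ^ 2 - 1) / 2) := by
      rw [hu]
      field_simp
    have hone : 1 ≤ x ^ 2 / σ₂ ^ 2 := by
      rw [one_le_div (by positivity)]
      gcongr
    have ht : 1 < σ₂ / σ₁ := (one_lt_div h₁).2 h₁₂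
    have hle : ((σ₂ / σ₁) ^ 2 - 1) / 2 ≤ u := by
      rw [hfactor]
      exact le_mul_of_one_le_left (by nlinarith) hone
    nlinarith
  have hexp : σ₂ / σ₁ < Real.exp u := hratio.trans_le (by linarith [Real.add_one_le_exp u])
  rw [div_lt_iff₀ h₁] at hexp
  have hsplit : Real.exp (-x ^ 2 / (2 * σ₂ ^ 2)) =
      Real.exp u * Real.exp (-x ^ 2 / (2 * σ₁ ^ 2)) := by
    rw [← Real.exp_add, hu]
    congr 1
    ring
  have hpi : 0 < √(2 * π) := by positivity
  unfold gauss
  rw [hsplit, ← mul_assoc]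
  refine mul_lt_mul_of_pos_right ?_ (Real.exp_pos _)
  rw [one_div_mul_eq_div, div_lt_div_iff₀ (by positivity) (by positivity)]
  nlinarith

theorem V_strictMono_on_Ioc (d w : ℝ) (hd : 0 < d) (hw : 0 < w) (Q : ℝ → ℝ)
    (hQmeas : Measurable Q) (hQbdd : ∃ C : ℝ, ∀ x, Q x ≤ C)
    (hQnonneg : ∀ x, 0 ≤ Q x)
    (hQsupp : ∀ x, x ∉ Set.Icc d (d + w) → Q x = 0)
    (hQne : ¬ (Q =ᵐ[volume] 0)) :
    ∀ σ₁ σ₂ : ℝ, 0 < σ₁ → σ₁ < σ₂ → σ₂ ≤ d → V Q σ₁ < V Q σ₂ := by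
  intro σ₁ σ₂ h₁ h₁₂ h₂d
  obtain ⟨C, hC⟩ := hQbdd
  have hlt : ∀ x, Q x ≠ 0 → gauss σ₁ x < gauss σ₂ x := fun x hx =>
    gauss_lt_gauss h₁ h₁₂ (h₂d.trans (not_imp_comm.1 (hQsupp x) hx).1)
  have hi₁ := integrable_gauss_mul h₁ hQmeas hC hQnonneg
  have hi₂ := integrable_gauss_mul (h₁.trans h₁₂) hQmeas hC hQnonneg
  rw [← sub_pos, V, V, ← integral_sub hi₂ hi₁]
  refine (integral_pos_iff_support_of_nonneg (fun x => ?_) (hi₂.sub hi₁)).2 ?_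
  · by_cases hx : Q x = 0
    · simp [hx]
    · exact sub_nonneg.2 (mul_le_mul_of_nonneg_right (hlt x hx).le (hQnonneg x))
  · refine (pos_iff_ne_zero.2 fun h => hQne (ae_iff.2 h)).trans_le (measure_mono fun x hx => ?_)
    have hpos := mul_pos (sub_pos.2 (hlt x hx)) ((hQnonneg x).lt_of_ne' hx)
    rw [sub_mul] at hpos
    exact hpos.ne'
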